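/- arXiv:2202.07071 — 4 statements merged into one kernel-verified Lean document; each statement's English description precedes it below -/
import Mathlib

section
/- Let 0 < l < U, let X_1,...,X_n be reals with l ≤ X_i ≤ U for all i, let w_1,...,w_n be strictly positive weights, and let p > q > 0. Then the difference of weighted power means satisfies M_n^[p](X,w) − M_n^[q](X,w) ≤ sup_{θ ∈ [0,1]} [ (θ U^p + (1−θ) l^p)^{1/p} − (θ U^q + (1−θ) l^q)^{1/q} ]. -/
open Finset

/-- The weighted power mean `M_n^[p](X, w) = ((∑ i, w i * X i ^ p) / (∑ i, w i)) ^ (1/p)`. -/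
noncomputable def powerMean {n : ℕ} (X w : Fin n → ℝ) (p : ℝ) : ℝ :=
  ((∑ i, w i * X i ^ p) / (∑ i, w i)) ^ (1 / p)

/-- Since `t ↦ t ^ (p / q)` is convex, `x ^ p` lies below the chord parametrised by `x ^ q`. -/
lemma exists_rpow_eq_and_rpow_le_chord {l U x p q : ℝ} (hl : 0 < l) (hlU : l < U) (hlx : l ≤ x)
    (hxU : x ≤ U) (hq : 0 < q) (hpq : q < p) :
    ∃ θ : ℝ, 0 ≤ θ ∧ θ ≤ 1 ∧ x ^ q = θ * U ^ q + (1 - θ) * l ^ q ∧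
      x ^ p ≤ θ * U ^ p + (1 - θ) * l ^ p := by
  have hx : 0 < x := hl.trans_le hlx
  have hU : 0 < U := hl.trans hlU
  have hd : 0 < U ^ q - l ^ q := sub_pos.2 (Real.rpow_lt_rpow hl.le hlU hq)
  have hlq : l ^ q ≤ x ^ q := Real.rpow_le_rpow hl.le hlx hq.le
  have hxq : x ^ q ≤ U ^ q := Real.rpow_le_rpow hx.le hxU hq.le
  have hpow {y : ℝ} (hy : 0 < y) : (y ^ q) ^ (p / q) = y ^ p := by
    rw [← Real.rpow_mul hy.le, mul_div_cancel₀ _ hq.ne']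
  set θ : ℝ := (x ^ q - l ^ q) / (U ^ q - l ^ q)
  have h0 : 0 ≤ θ := div_nonneg (sub_nonneg.2 hlq) hd.le
  have h1 : θ ≤ 1 := (div_le_one hd).2 (by linarith)
  have heq : x ^ q = θ * U ^ q + (1 - θ) * l ^ q := by
    have : θ * (U ^ q - l ^ q) = x ^ q - l ^ q := div_mul_cancel₀ _ hd.ne'
    linarith
  refine ⟨θ, h0, h1, heq, ?_⟩
  have hconv := (convexOn_rpow ((one_le_div hq).2 hpq.le)).2
    (Set.mem_Ici.2 (Real.rpow_nonneg hU.le q)) (Set.mem_Ici.2 (Real.rpow_nonneg hl.le q))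
    h0 (sub_nonneg.2 h1) (add_sub_cancel θ 1)
  simp only [smul_eq_mul] at hconv
  rwa [← heq, hpow hx, hpow hU, hpow hl] at hconv

lemma bddAbove_range_chord_sub {l U p q : ℝ} (hl : 0 < l) (hlU : l < U) (hp : 0 < p) :
    BddAbove (Set.range fun θ : Set.Icc (0 : ℝ) 1 =>
      (θ * U ^ p + (1 - (θ : ℝ)) * l ^ p) ^ (1 / p)
        - ((θ : ℝ) * U ^ q + (1 - (θ : ℝ)) * l ^ q) ^ (1 / q)) := by
  have hU : 0 < U := hl.trans hlU
  refine ⟨U, ?_⟩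
  rintro _ ⟨⟨θ, h0, h1⟩, rfl⟩
  have h1' : 0 ≤ 1 - θ := sub_nonneg.2 h1
  have hle : θ * U ^ p + (1 - θ) * l ^ p ≤ U ^ p := by
    have := mul_le_mul_of_nonneg_left (Real.rpow_le_rpow hl.le hlU.le hp.le) h1'
    linarith
  have hfst : (θ * U ^ p + (1 - θ) * l ^ p) ^ (1 / p) ≤ U := by
    calc (θ * U ^ p + (1 - θ) * l ^ p) ^ (1 / p) ≤ (U ^ p) ^ (1 / p) :=
          Real.rpow_le_rpow (by positivity) hle (by positivity)
      _ = U := by rw [one_div, Real.rpow_rpow_inv hU.le hp.ne']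
  have hsnd : 0 ≤ (θ * U ^ q + (1 - θ) * l ^ q) ^ (1 / q) := by positivity
  exact (sub_le_self _ hsnd).trans hfst

/-- For `l ≤ X i ≤ U` and `p > q > 0`, the difference of weighted power means is bounded by
`sup_{θ ∈ [0,1]} ((θ U^p + (1−θ) l^p)^{1/p} − (θ U^q + (1−θ) l^q)^{1/q})`. -/
theorem powerMean_sub_le {n : ℕ} (l U : ℝ) (hl : 0 < l) (hlU : l < U)
    (X w : Fin n → ℝ) (hX : ∀ i, l ≤ X i ∧ X i ≤ U) (hw : ∀ i, 0 < w i)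
    (p q : ℝ) (hq : 0 < q) (hpq : q < p) :
    powerMean X w p - powerMean X w q ≤
      ⨆ θ : Set.Icc (0 : ℝ) 1,
        ((θ * U ^ p + (1 - (θ : ℝ)) * l ^ p) ^ (1 / p)
          - ((θ : ℝ) * U ^ q + (1 - (θ : ℝ)) * l ^ q) ^ (1 / q)) := by
  have hp : 0 < p := hq.trans hpq
  have hbdd := bddAbove_range_chord_sub (q := q) hl hlU hp
  rcases n.eq_zero_or_pos with rfl | hn
  · refine le_ciSup_of_le hbdd ⟨0, by simp⟩ ?_
    simp [powerMean, hp.ne', hq.ne', Real.rpow_rpow_inv hl.le]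
  choose θ h0 h1 heq hle using fun i =>
    exists_rpow_eq_and_rpow_le_chord hl hlU (hX i).1 (hX i).2 hq hpq
  have : Nonempty (Fin n) := ⟨⟨0, hn⟩⟩
  have hW : 0 < ∑ i, w i := sum_pos (fun i _ => hw i) univ_nonempty
  have hmean (r : ℝ) : (∑ i, w i * (θ i * U ^ r + (1 - θ i) * l ^ r)) / ∑ i, w i =
      (∑ i, w i * θ i) / (∑ i, w i) * U ^ r
        + (1 - (∑ i, w i * θ i) / ∑ i, w i) * l ^ r := by
    have : ∑ i, w i * (θ i * U ^ r + (1 - θ i) * l ^ r) =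
        (∑ i, w i * θ i) * U ^ r + (∑ i, w i - ∑ i, w i * θ i) * l ^ r := by
      rw [← sum_sub_distrib, sum_mul, sum_mul, ← sum_add_distrib]
      exact sum_congr rfl fun i _ => by ring
    rw [this]
    field_simp
  refine le_ciSup_of_le hbdd ⟨(∑ i, w i * θ i) / ∑ i, w i, ?_, ?_⟩ ?_
  · exact div_nonneg (sum_nonneg fun i _ => mul_nonneg (hw i).le (h0 i)) hW.le
  · exact (div_le_one hW).2 (sum_le_sum fun i _ => mul_le_of_le_one_right (hw i).le (h1 i))
  · simp only [powerMean, ← hmean, ← heq]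
    refine sub_le_sub_right (Real.rpow_le_rpow ?_ ?_ (one_div_pos.2 hp).le) _
    · exact div_nonneg (sum_nonneg fun i _ =>
        mul_nonneg (hw i).le (Real.rpow_nonneg (hl.le.trans (hX i).1) p)) hW.le
    · exact div_le_div_of_nonneg_right
        (sum_le_sum fun i _ => mul_le_mul_of_nonneg_left (hle i) (hw i).le) hW.le
end

section
/- Let 0 < l < U, C = U/l, let X_1,...,X_n be reals with l ≤ X_i ≤ U for all i, let w_1,...,w_n be strictly positive weights, and let p > q > 0. Then the ratio of weighted power means satisfies M_n^[p](X,w) / M_n^[q](X,w) ≤ ( q(C^p − C^q) / ((p−q)(C^q − 1)) )^{1/p} · ( p(C^q − C^p) / ((q−p)(C^p − 1)) )^{−1/q}. -/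
open Finset

/-- On `[1, C]` the function `y ^ p` lies below its chord as a convex function of `y ^ q`. -/
lemma rpow_chord_le {C y p q : ℝ} (hC : 1 < C) (hy : 1 ≤ y) (hyC : y ≤ C) (hq : 0 < q)
    (hpq : q < p) : (C ^ q - 1) * y ^ p + (C ^ p - C ^ q) ≤ (C ^ p - 1) * y ^ q := by
  have hb : 0 < C ^ q - 1 := sub_pos.2 (Real.one_lt_rpow hC hq)
  have ht : 0 ≤ y ^ q - 1 := sub_nonneg.2 (Real.one_le_rpow hy hq.le)
  have htb : 0 ≤ C ^ q - y ^ q :=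
    sub_nonneg.2 (Real.rpow_le_rpow (by linarith) hyC hq.le)
  have hpow : ∀ z : ℝ, 0 ≤ z → (z ^ q) ^ (p / q) = z ^ p := fun z hz => by
    rw [← Real.rpow_mul hz, mul_div_cancel₀ _ hq.ne']
  have key := (convexOn_rpow ((one_le_div hq).2 hpq.le)).2
    (Set.mem_Ici.2 zero_le_one) (Set.mem_Ici.2 (by linarith : (0 : ℝ) ≤ C ^ q))
    (div_nonneg htb hb.le) (div_nonneg ht hb.le) (by field_simp; ring)
  have hcomb : (C ^ q - y ^ q) / (C ^ q - 1) * 1 + (y ^ q - 1) / (C ^ q - 1) * C ^ q = y ^ q := by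
    field_simp
    ring
  simp only [smul_eq_mul, Real.one_rpow] at key
  rw [hcomb, hpow y (by linarith), hpow C (by linarith), div_mul_eq_mul_div, div_mul_eq_mul_div,
    ← add_div, le_div_iff₀ hb] at key
  linarith

lemma powerMean_const_mul {n : ℕ} {l p : ℝ} (hl : 0 < l) (hp : p ≠ 0) {X w : Fin n → ℝ}
    (hX : ∀ i, 0 ≤ X i) (hw : ∀ i, 0 ≤ w i) :
    powerMean (fun i => l * X i) w p = l * powerMean X w p := by
  have hsum : ∑ i, w i * (l * X i) ^ p = l ^ p * ∑ i, w i * X i ^ p := by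
    rw [mul_sum]
    refine sum_congr rfl fun i _ => ?_
    rw [Real.mul_rpow hl.le (hX i)]
    ring
  unfold powerMean
  rw [hsum, mul_div_assoc, Real.mul_rpow (by positivity), ← Real.rpow_mul hl.le,
    mul_one_div_cancel hp, Real.rpow_one]
  exact div_nonneg (sum_nonneg fun i _ => mul_nonneg (hw i) (Real.rpow_nonneg (hX i) p))
    (sum_nonneg fun i _ => hw i)

/-- Weighted AM-GM turns a linear bound on `A` in terms of `B` into a bound on
`A ^ (1 / p) / B ^ (1 / q)`. -/
lemma rpow_div_rpow_le_of_linear {A B a b p q : ℝ} (hA : 0 ≤ A) (hB : 0 < B) (hb : 1 < b)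
    (hab : b < a) (hq : 0 < q) (hpq : q < p)
    (h : (b - 1) * A + (a - b) ≤ (a - 1) * B) :
    A ^ (1 / p) / B ^ (1 / q) ≤ (q * (a - b) / ((p - q) * (b - 1))) ^ (1 / p)
      * (p * (b - a) / ((q - p) * (a - 1))) ^ (-(1 / q)) := by
  have hp : 0 < p := hq.trans hpq
  have hpq' : 0 < p - q := sub_pos.2 hpq
  have hab' : 0 < a - b := sub_pos.2 hab
  have hb' : 0 < b - 1 := sub_pos.2 hb
  have ha' : 0 < a - 1 := by linarith
  have hBeq : p * (b - a) / ((q - p) * (a - 1)) = p * (a - b) / ((p - q) * (a - 1)) := by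
    rw [← neg_sub a b, ← neg_sub p q, mul_neg, neg_mul, neg_div_neg_eq]
  rw [hBeq]
  set A₀ := q * (a - b) / ((p - q) * (b - 1)) with hA₀
  set B₀ := p * (a - b) / ((p - q) * (a - 1)) with hB₀
  have hA₀pos : 0 < A₀ := by positivity
  have hB₀pos : 0 < B₀ := by positivity
  have amgm := Real.geom_mean_le_arith_mean2_weighted (w₁ := q / p) (w₂ := (p - q) / p)
    (p₁ := A / A₀) (p₂ := 1) (by positivity) (by positivity) (by positivity) zero_le_one
    (by field_simp; ring)
  have hlin : q / p * (A / A₀) + (p - q) / p * 1 ≤ B / B₀ := by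
    have e₁ : q / p * (A / A₀) + (p - q) / p * 1
        = (p - q) / (p * (a - b)) * ((b - 1) * A + (a - b)) := by
      rw [hA₀]; field_simp
    have e₂ : B / B₀ = (p - q) / (p * (a - b)) * ((a - 1) * B) := by
      rw [hB₀]; field_simp
    rw [e₁, e₂]
    gcongr
  rw [Real.one_rpow, mul_one] at amgm
  have hroot := Real.rpow_le_rpow (by positivity) (amgm.trans hlin)
    (by positivity : 0 ≤ 1 / q)
  rw [← Real.rpow_mul (by positivity), show q / p * (1 / q) = 1 / p by field_simp,
    Real.div_rpow hA hA₀pos.le, Real.div_rpow hB.le hB₀pos.le,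
    div_le_div_iff₀ (by positivity) (by positivity)] at hroot
  rw [Real.rpow_neg hB₀pos.le, ← div_eq_mul_inv, div_le_div_iff₀ (by positivity) (by positivity)]
  linarith

/-- For `0 < l < U`, `C = U / l`, `l ≤ X i ≤ U` and `p > q > 0`, the ratio of weighted power
means is bounded by
`(q (C^p − C^q) / ((p−q)(C^q − 1)))^{1/p} · (p (C^q − C^p) / ((q−p)(C^p − 1)))^{−1/q}`. -/
theorem powerMean_div_le {n : ℕ} (l U C : ℝ) (hl : 0 < l) (hlU : l < U) (hC : C = U / l)
    (X w : Fin n → ℝ) (hX : ∀ i, l ≤ X i ∧ X i ≤ U) (hw : ∀ i, 0 < w i)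
    (p q : ℝ) (hq : 0 < q) (hpq : q < p) :
    powerMean X w p / powerMean X w q ≤
      (q * (C ^ p - C ^ q) / ((p - q) * (C ^ q - 1))) ^ (1 / p)
        * (p * (C ^ q - C ^ p) / ((q - p) * (C ^ p - 1))) ^ (-(1 / q)) := by
  have hp : 0 < p := hq.trans hpq
  have hC1 : 1 < C := by rw [hC]; exact (one_lt_div hl).2 hlU
  have hCq : 1 < C ^ q := Real.one_lt_rpow hC1 hq
  have hCpq : C ^ q < C ^ p := Real.rpow_lt_rpow_of_exponent_lt hC1 hpq
  obtain ⟨Y, hY⟩ : ∃ Y : Fin n → ℝ, X = fun i => l * Y i :=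
    ⟨fun i => X i / l, funext fun i => (mul_div_cancel₀ (X i) hl.ne').symm⟩
  have hY1 : ∀ i, 1 ≤ Y i := fun i => by
    have := (hX i).1
    rw [hY] at this
    exact (le_mul_iff_one_le_right hl).1 this
  have hYC : ∀ i, Y i ≤ C := fun i => by
    have := (hX i).2
    rw [hY] at this
    rw [hC, le_div_iff₀ hl]
    linarith
  have hY0 : ∀ i, 0 < Y i := fun i => one_pos.trans_le (hY1 i)
  rw [hY, powerMean_const_mul hl hp.ne' (fun i => (hY0 i).le) fun i => (hw i).le,
    powerMean_const_mul hl hq.ne' (fun i => (hY0 i).le) fun i => (hw i).le,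
    mul_div_mul_left _ _ hl.ne']
  rcases isEmpty_or_nonempty (Fin n) with hn | hn
  · have hzero : powerMean Y w p = 0 := by
      simp [powerMean, hp.ne']
    rw [hzero, zero_div, ← neg_sub (C ^ p) (C ^ q), ← neg_sub p q, mul_neg, neg_mul,
      neg_div_neg_eq]
    have := sub_pos.2 hpq
    have := sub_pos.2 hCpq
    have := sub_pos.2 hCq
    have := sub_pos.2 (hCq.trans hCpq)
    positivity
  have hW : 0 < ∑ i, w i := sum_pos (fun i _ => hw i) univ_nonempty
  have hS : ∀ r : ℝ, 0 < ∑ i, w i * Y i ^ r := fun r =>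
    sum_pos (fun i _ => mul_pos (hw i) (Real.rpow_pos_of_pos (hY0 i) r)) univ_nonempty
  refine rpow_div_rpow_le_of_linear (div_pos (hS p) hW).le (div_pos (hS q) hW) hCq hCpq hq hpq ?_
  have hsum : (C ^ q - 1) * ∑ i, w i * Y i ^ p + (C ^ p - C ^ q) * ∑ i, w i
      ≤ (C ^ p - 1) * ∑ i, w i * Y i ^ q := by
    simp only [mul_sum, ← sum_add_distrib]
    refine sum_le_sum fun i _ => ?_
    linarith [mul_le_mul_of_nonneg_left (rpow_chord_le hC1 (hY1 i) (hYC i) hq hpq) (hw i).le]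
  rw [← mul_div_assoc, ← mul_div_assoc, div_add' _ _ _ hW.ne']
  gcongr
end

section
/- Let A be a finite nonempty set, τ > 0, and Q : A → ℝ. For the Tsallis regularizer Ω(π) = (1/2)(Σ_{a∈A} π(a)² − 1), the unique maximizer over Δ(A) of π ↦ Σ_{a∈A} π(a)Q(a) − τΩ(π) is the Euclidean projection of the vector (Q(a)/τ)_{a∈A} onto the simplex Δ(A) ⊂ ℝ^A (the sparsemax of Q/τ). -/
open Finset

/-- If the midpoint of `p` and `q` is at least as far from `x` as both `p` and `q`, which are
equidistant from `x`, then `p = q`. -/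
lemma eq_of_sum_sq_sub_le_midpoint {A : Type*} [Fintype A] {p q x : A → ℝ}
    (hpq : ∑ a, (p a - x a) ^ 2 = ∑ a, (q a - x a) ^ 2)
    (hmid : ∑ a, (q a - x a) ^ 2 ≤ ∑ a, (midpoint ℝ p q a - x a) ^ 2) : p = q := by
  have parallelogram : ∑ a, (midpoint ℝ p q a - x a) ^ 2 =
      (1 / 2) * ∑ a, (p a - x a) ^ 2 + (1 / 2) * ∑ a, (q a - x a) ^ 2
        - (1 / 4) * ∑ a, (p a - q a) ^ 2 := by
    simp only [mul_sum, ← sum_add_distrib, ← sum_sub_distrib]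
    refine sum_congr rfl fun a _ => ?_
    simp only [midpoint_eq_smul_add, Pi.smul_apply, Pi.add_apply, smul_eq_mul, invOf_eq_inv]
    ring
  have hzero : ∑ a, (p a - q a) ^ 2 = 0 :=
    le_antisymm (by linarith) (sum_nonneg fun a _ => sq_nonneg _)
  rw [sum_eq_zero_iff_of_nonneg fun a _ => sq_nonneg _] at hzero
  funext a
  exact sub_eq_zero.mp (pow_eq_zero_iff two_ne_zero |>.mp (hzero a (mem_univ a)))

/-- The Euclidean projection onto a nonempty compact convex set exists and is unique. -/
lemma exists_unique_sum_sq_sub_minimizer {A : Type*} [Fintype A] {s : Set (A → ℝ)}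
    (hne : s.Nonempty) (hcompact : IsCompact s) (hconvex : Convex ℝ s) (x : A → ℝ) :
    ∃ q ∈ s, (∀ p ∈ s, ∑ a, (q a - x a) ^ 2 ≤ ∑ a, (p a - x a) ^ 2) ∧
      ∀ p ∈ s, ∑ a, (p a - x a) ^ 2 = ∑ a, (q a - x a) ^ 2 → p = q := by
  obtain ⟨q, hq, hmin⟩ := hcompact.exists_isMinOn hne
    (f := fun p : A → ℝ => ∑ a, (p a - x a) ^ 2) (by fun_prop)
  rw [isMinOn_iff] at hmin
  exact ⟨q, hq, hmin, fun p hp hpq =>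
    eq_of_sum_sq_sub_le_midpoint hpq (hmin _ (hconvex.midpoint_mem hp hq))⟩

/-- Completing the square in the Tsallis-regularized objective. -/
lemma tsallis_objective_eq_sub_sum_sq {A : Type*} [Fintype A] {τ : ℝ} (hτ : τ ≠ 0)
    (Q p : A → ℝ) :
    (∑ a, p a * Q a) - τ * ((1 / 2 : ℝ) * ((∑ a, (p a) ^ 2) - 1)) =
      τ / 2 + τ / 2 * ∑ a, (Q a / τ) ^ 2 - τ / 2 * ∑ a, (p a - Q a / τ) ^ 2 := by
  have hsum : τ / 2 * ∑ a, (p a - Q a / τ) ^ 2 =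
      τ / 2 * ∑ a, (p a) ^ 2 - ∑ a, p a * Q a + τ / 2 * ∑ a, (Q a / τ) ^ 2 := by
    simp only [mul_sum, ← sum_add_distrib, ← sum_sub_distrib]
    refine sum_congr rfl fun a _ => ?_
    field_simp
    ring
  rw [hsum]
  ring

/-- For the Tsallis regularizer `Ω(π) = (1/2)(∑ a, π a ² − 1)`, there is a unique maximizer
over the simplex of `π ↦ ∑ a, π a * Q a − τ Ω(π)`, and it is the Euclidean projection of
`Q/τ` onto the simplex (the sparsemax of `Q/τ`). -/
theorem tsallis_argmax_eq_sparsemax (A : Type*) [Fintype A] [Nonempty A] (τ : ℝ) (hτ : 0 < τ)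
    (Om : (A → ℝ) → ℝ) (hOm : ∀ p, Om p = (1 / 2 : ℝ) * ((∑ a, (p a) ^ 2) - 1))
    (Q : A → ℝ) :
    ∃ pStar : A → ℝ, pStar ∈ stdSimplex ℝ A ∧
      (∀ p ∈ stdSimplex ℝ A,
        (∑ a, p a * Q a) - τ * Om p ≤ (∑ a, pStar a * Q a) - τ * Om pStar) ∧
      (∀ p ∈ stdSimplex ℝ A,
        (∑ a, p a * Q a) - τ * Om p = (∑ a, pStar a * Q a) - τ * Om pStar → p = pStar) ∧
      (∀ p ∈ stdSimplex ℝ A,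
        ∑ a, (pStar a - Q a / τ) ^ 2 ≤ ∑ a, (p a - Q a / τ) ^ 2) ∧
      (∀ p ∈ stdSimplex ℝ A,
        ∑ a, (p a - Q a / τ) ^ 2 = ∑ a, (pStar a - Q a / τ) ^ 2 → p = pStar) := by
  obtain ⟨q, hq, hmin, huniq⟩ := exists_unique_sum_sq_sub_minimizer
    (Set.nonempty_coe_sort.mp (inferInstance : Nonempty (stdSimplex ℝ A))) (isCompact_stdSimplex ℝ A)
    (convex_stdSimplex ℝ A) (fun a => Q a / τ)
  have hτ2 : 0 < τ / 2 := half_pos hτ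
  refine ⟨q, hq, fun p hp => ?_, fun p hp hpq => huniq p hp ?_, hmin, huniq⟩
  · rw [hOm, hOm, tsallis_objective_eq_sub_sum_sq hτ.ne', tsallis_objective_eq_sub_sum_sq hτ.ne']
    exact sub_le_sub_left (mul_le_mul_of_nonneg_left (hmin p hp) hτ2.le) _
  · rw [hOm, hOm, tsallis_objective_eq_sub_sum_sq hτ.ne',
      tsallis_objective_eq_sub_sum_sq hτ.ne'] at hpq
    exact mul_left_cancel₀ hτ2.ne' (sub_right_injective hpq)
end

section
/- Let a_1,...,a_n be strictly positive reals, let w_1,...,w_n be strictly positive weights with Σ_{i=1}^n w_i = 1, let p be a real number with p ∉ {0, 1}, and define f_p : (0,∞) → ℝ by f_p(x) = (x^{1−p} − p)/(p(p−1)) + x/p. Then the function g(x) = Σ_{i=1}^n w_i a_i f_p(x/a_i) has a unique minimizer over x > 0, and this minimizer equals the weighted power mean (Σ_{i=1}^n w_i a_i^p)^{1/p}; i.e., the entropic mean generated by the α-function distance coincides with the power mean. -/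
open Finset

/-- Strict Bernoulli inequality for real exponents, normalised so that it holds for every
exponent other than `0` and `1`. -/
theorem bernoulli_rpow_div_pos {t q : ℝ} (ht : 0 < t) (ht1 : t ≠ 1) (hq0 : q ≠ 0) (hq1 : q ≠ 1) :
    0 < (t ^ q - 1 - q * (t - 1)) / (q * (q - 1)) := by
  have hs : (-1 : ℝ) ≤ t - 1 := by linarith
  have hs' : t - 1 ≠ 0 := sub_ne_zero.mpr ht1
  have hadd : 1 + (t - 1) = t := by ring
  rcases lt_or_gt_of_ne hq0 with hneg | hpos
  · apply div_pos _ (by nlinarith)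
    have hlog := mul_lt_mul_of_neg_left (Real.log_lt_sub_one_of_pos ht ht1) hneg
    have hexp := Real.add_one_le_exp (q * Real.log t)
    rw [Real.rpow_def_of_pos ht, mul_comm (Real.log t)]
    linarith
  · rcases lt_or_gt_of_ne hq1 with hlt | hgt
    · apply div_pos_of_neg_of_neg _ (by nlinarith)
      have h := rpow_one_add_lt_one_add_mul_self hs hs' hpos hlt
      rw [hadd] at h
      linarith
    · apply div_pos _ (by nlinarith)
      have h := one_add_mul_self_lt_rpow_one_add hs hs' hgt
      rw [hadd] at h
      linarith

/-- The entropic mean generated by the α-function distance coincides with the power mean: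
for positive `a_i`, positive weights `w_i` summing to one, and `p ∉ {0, 1}`, with
`f_p(x) = (x^{1−p} − p)/(p(p−1)) + x/p`, the function
`g(x) = ∑ i, w i * a i * f_p (x / a i)` has the weighted power mean
`(∑ i, w i * a i ^ p)^{1/p}` as its unique minimizer over `x > 0`. -/
theorem entropicMean_eq_powerMean {n : ℕ} (a w : Fin n → ℝ)
    (ha : ∀ i, 0 < a i) (hw : ∀ i, 0 < w i) (hwsum : ∑ i, w i = 1)
    (p : ℝ) (hp0 : p ≠ 0) (hp1 : p ≠ 1)
    (f : ℝ → ℝ) (hf : ∀ x, f x = (x ^ (1 - p) - p) / (p * (p - 1)) + x / p)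
    (g : ℝ → ℝ) (hg : ∀ x, g x = ∑ i, w i * a i * f (x / a i))
    (M : ℝ) (hM : M = (∑ i, w i * a i ^ p) ^ (1 / p)) :
    (∀ x, 0 < x → g M ≤ g x) ∧ (∀ x, 0 < x → g x = g M → x = M) := by
  have hne : (Finset.univ : Finset (Fin n)).Nonempty := by
    by_contra h
    simp [Finset.not_nonempty_iff_eq_empty.mp h] at hwsum
  set S := ∑ i, w i * a i ^ p with hS
  have hSpos : 0 < S :=
    Finset.sum_pos (fun i _ => mul_pos (hw i) (Real.rpow_pos_of_pos (ha i) p)) hne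
  have hMpos : 0 < M := hM ▸ Real.rpow_pos_of_pos hSpos _
  have hMp : M ^ p = S := by
    rw [hM, ← Real.rpow_mul hSpos.le, one_div_mul_cancel hp0, Real.rpow_one]
  have hp1' : p - 1 ≠ 0 := sub_ne_zero.mpr hp1
  have hgx : ∀ x, 0 < x →
      g x = S * x ^ (1 - p) / (p * (p - 1)) - (∑ i, w i * a i) / (p - 1) + x / p := by
    intro x hx
    have hx1 : x / p = ∑ i, w i * (x / p) := by rw [← Finset.sum_mul, hwsum, one_mul]
    rw [hg, hx1, hS, Finset.sum_mul, Finset.sum_div, Finset.sum_div, ← Finset.sum_sub_distrib,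
      ← Finset.sum_add_distrib]
    refine Finset.sum_congr rfl fun i _ => ?_
    have hai := (ha i).ne'
    have hap := (Real.rpow_pos_of_pos (ha i) p).ne'
    rw [hf, Real.div_rpow hx.le (ha i).le, Real.rpow_sub (ha i), Real.rpow_one]
    field_simp
  have hdiff : ∀ x, 0 < x → g x - g M =
      M * (((x / M) ^ (1 - p) - 1 - (1 - p) * (x / M - 1)) / ((1 - p) * (1 - p - 1))) := by
    intro x hx
    have hMp' := (Real.rpow_pos_of_pos hMpos p).ne'
    have hq : (1 - p) * (1 - p - 1) = p * (p - 1) := by ring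
    rw [hgx x hx, hgx M hMpos, hq, Real.div_rpow hx.le hMpos.le, ← hMp,
      Real.rpow_sub hMpos, Real.rpow_one]
    field_simp
    ring
  have hlt : ∀ x, 0 < x → x ≠ M → g M < g x := by
    intro x hx hxM
    have h1 : x / M ≠ 1 := fun h => hxM ((div_eq_one_iff_eq hMpos.ne').mp h)
    have h := mul_pos hMpos (bernoulli_rpow_div_pos (div_pos hx hMpos) h1
      (sub_ne_zero.mpr hp1.symm) (fun h => hp0 (by linarith)))
    rw [← hdiff x hx] at h
    linarith
  refine ⟨fun x hx => ?_, fun x hx h => ?_⟩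
  · rcases eq_or_ne x M with rfl | hxM
    · exact le_rfl
    · exact (hlt x hx hxM).le
  · by_contra hxM
    exact (hlt x hx hxM).ne' h
end
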